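/- For every irrational ρ∈(0,1), the pair (ρ, ρ/2) is admissible. -/

import Mathlib

noncomputable section

open Set Filter MeasureTheory Topology

/-- The circle `ℝ/ℤ`. -/
abbrev S1 := AddCircle (1 : ℝ)

/-- `F` is an (orientation-preserving) lift of the circle map `f`. -/
def IsLift (f : S1 → S1) (F : ℝ → ℝ) : Prop :=
  StrictMono F ∧ Function.Surjective F ∧ (∀ x : ℝ, F (x + 1) = F x + 1) ∧
    ∀ x : ℝ, f (x : S1) = (F x : S1)

/-- `f` is an orientation-preserving circle homeomorphism. -/
def IsCircleHomeo (f : S1 → S1) : Prop := ∃ F : ℝ → ℝ, IsLift f F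

/-- `f` has rotation number `ρ ∈ [0,1)`: some lift of `f` has translation number `ρ`. -/
def HasRotNum (f : S1 → S1) (ρ : ℝ) : Prop :=
  ∃ F : ℝ → ℝ, IsLift f F ∧ Tendsto (fun n : ℕ => F^[n] 0 / (n : ℝ)) atTop (𝓝 ρ)

/-- The lift `F` has a non-flat (power-law) critical point at `c`:
on a neighbourhood `W` of `c`, `F y = F c + φ(y)|φ(y)|^(d-1)` for a `C³` diffeomorphism `φ`
with `φ c = 0`. -/
def NonFlatAt (F : ℝ → ℝ) (c : ℝ) : Prop :=
  ∃ d : ℝ, 1 < d ∧ ∃ W : Set ℝ, IsOpen W ∧ c ∈ W ∧ ∃ φ : ℝ → ℝ,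
    ContDiffOn ℝ 3 φ W ∧ InjOn φ W ∧ (∀ y ∈ W, deriv φ y ≠ 0) ∧ φ c = 0 ∧
    ∀ y ∈ W, F y = F c + φ y * |φ y| ^ (d - 1)

/-- `f` is a `C^k` unicritical circle map: an orientation-preserving `C^k` circle
homeomorphism whose only critical point is `c`, and it is non-flat. -/
def Unicritical (f : S1 → S1) (c : S1) (k : ℕ∞) : Prop :=
  ∃ (F : ℝ → ℝ) (x₀ : ℝ), IsLift f F ∧ ContDiff ℝ k F ∧ (x₀ : S1) = c ∧
    {x : ℝ | deriv F x = 0} = {x : ℝ | ∃ m : ℤ, x = x₀ + m} ∧ NonFlatAt F x₀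

/-- `f` is a `C^k` bi-critical circle map: an orientation-preserving `C^k` circle
homeomorphism with exactly two critical points `c₁ ≠ c₂`, both non-flat. -/
def Bicritical (f : S1 → S1) (c₁ c₂ : S1) (k : ℕ∞) : Prop :=
  c₁ ≠ c₂ ∧ ∃ (F : ℝ → ℝ) (x₁ x₂ : ℝ), IsLift f F ∧ ContDiff ℝ k F ∧
    (x₁ : S1) = c₁ ∧ (x₂ : S1) = c₂ ∧
    {x : ℝ | deriv F x = 0} =
      {x : ℝ | ∃ m : ℤ, x = x₁ + m} ∪ {x : ℝ | ∃ m : ℤ, x = x₂ + m} ∧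
    NonFlatAt F x₁ ∧ NonFlatAt F x₂

/-- `h` is a quasisymmetric (orientation-preserving) circle homeomorphism. -/
def QuasiSymm (h : S1 → S1) : Prop :=
  ∃ H : ℝ → ℝ, IsLift h H ∧ ∃ M : ℝ, 1 < M ∧ ∀ x t : ℝ, 0 < t →
    1 / M ≤ (H (x + t) - H x) / (H x - H (x - t)) ∧
      (H (x + t) - H x) / (H x - H (x - t)) ≤ M

/-- The length (in `[0,1)`) of the positively oriented arc from `x` to `y`. -/
def arcLen (x y : S1) : ℝ := (AddCircle.equivIco 1 0 (y - x) : ℝ)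

/-- The positively oriented open arc from `x` to `y` on the circle. -/
def posArc (x y : S1) : Set S1 := (fun t : ℝ => x + (t : S1)) '' Ioo 0 (arcLen x y)

/-- A pair `(ρ,α)` is admissible if there is a `C^∞` bi-critical circle map `g` with rotation
number `ρ`, unique invariant measure `μ`, and critical points `c₁, c₂` such that the two
connected components of `S¹ ∖ {c₁,c₂}` have `μ`-measures `α` and `1-α` respectively. -/
def Admissible (ρ α : ℝ) : Prop :=
  ∃ (g : S1 → S1) (c₁ c₂ : S1) (μ : Measure S1),
    Bicritical g c₁ c₂ ⊤ ∧ HasRotNum g ρ ∧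
    IsProbabilityMeasure μ ∧ μ.map g = μ ∧
    (μ (posArc c₁ c₂)).toReal = α ∧ (μ (posArc c₂ c₁)).toReal = 1 - α

theorem coe_S1_eq_iff {x y : ℝ} : (x : S1) = (y : S1) ↔ ∃ m : ℤ, x = y + m := by
  rw [← sub_eq_zero, ← AddCircle.coe_sub, AddCircle.coe_eq_zero_iff]
  refine exists_congr fun m => ?_
  rw [zsmul_eq_mul, mul_one]
  constructor <;> intro h <;> linarith

theorem posArc_coe {u v : ℝ} (h : u < v) (h1 : v < u + 1) :
    posArc (u : S1) (v : S1) = (fun x : ℝ => (x : S1)) '' Ioo u v := by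
  have hlen : arcLen (u : S1) (v : S1) = v - u := by
    rw [arcLen, ← AddCircle.coe_sub,
      AddCircle.equivIco_coe_eq (p := (1 : ℝ)) (a := 0) ⟨by linarith, by linarith⟩]
  rw [posArc, hlen]
  ext z
  constructor
  · rintro ⟨t, ⟨h0, h2⟩, rfl⟩
    exact ⟨u + t, ⟨by linarith, by linarith⟩, AddCircle.coe_add _ _ _⟩
  · rintro ⟨t, ⟨h0, h2⟩, rfl⟩
    refine ⟨t - u, ⟨by linarith, by linarith⟩, ?_⟩
    simp only
    rw [← AddCircle.coe_add, add_sub_cancel]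

namespace CircleDeg1Lift

/-- The translation number depends continuously on a jointly continuous parameter. -/
theorem continuous_translationNumber_of_continuous {T : Type*} [TopologicalSpace T]
    (F : T → CircleDeg1Lift) (hF : Continuous fun p : T × ℝ => F p.1 p.2) :
    Continuous fun t => translationNumber (F t) := by
  have hiter : ∀ n : ℕ, Continuous fun t => (F t ^ n) 0 := by
    intro n
    induction n with
    | zero => simpa using continuous_const
    | succ n ih =>
      have : (fun t => (F t ^ (n + 1)) 0) = fun t => F t ((F t ^ n) 0) := by
        funext t
        rw [pow_succ', mul_apply]
      rw [this]
      exact hF.comp (continuous_id.prodMk ih)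
  have hunif : TendstoUniformly (fun (n : ℕ) t => (F t ^ n) 0 / n)
      (fun t => translationNumber (F t)) atTop := by
    rw [Metric.tendstoUniformly_iff]
    intro ε hε
    obtain ⟨N, hN⟩ := exists_nat_gt (1 / ε)
    filter_upwards [eventually_ge_atTop (max N 1)] with n hn t
    have hn1 : (1 : ℝ) ≤ n := by exact_mod_cast (le_max_right N 1).trans hn
    have hnN : (N : ℝ) ≤ n := by exact_mod_cast (le_max_left N 1).trans hn
    have hpos : (0 : ℝ) < n := by linarith
    have hd := dist_pow_map_zero_mul_translationNumber_le (F t) n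
    rw [Real.dist_eq] at hd
    rw [dist_comm, Real.dist_eq]
    have hrw : (F t ^ n) 0 / n - translationNumber (F t)
        = ((F t ^ n) 0 - n * translationNumber (F t)) / n := by
      field_simp
    rw [hrw, abs_div, abs_of_pos hpos, div_lt_iff₀ hpos]
    have : 1 < ε * n := by
      have := hN.trans_le hnN
      rwa [div_lt_iff₀' hε] at this
    linarith
  exact hunif.continuous (Frequently.of_forall fun n => (hiter n).div_const _)

/-- The self-map of the circle covered by a degree one lift. -/
def circleMap (F : CircleDeg1Lift) : S1 → S1 :=
  Function.Periodic.lift (f := fun x : ℝ => (F x : S1)) (c := 1) fun x => by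
    simp

theorem circleMap_coe (F : CircleDeg1Lift) (x : ℝ) : circleMap F (x : S1) = (F x : S1) := rfl

theorem isLift_circleMap {F : CircleDeg1Lift} (hF : StrictMono F) (hs : Function.Surjective F) :
    IsLift (circleMap F) F :=
  ⟨hF, hs, F.map_add_one, circleMap_coe F⟩

theorem measurable_circleMap (F : CircleDeg1Lift) : Measurable (circleMap F) := by
  have h : circleMap F = fun x : S1 =>
      ((F (AddCircle.measurableEquivIco 1 0 x : ℝ) : ℝ) : S1) := by
    funext x
    conv_lhs => rw [← AddCircle.coe_equivIco (p := (1 : ℝ)) (a := 0) (y := x)]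
    rfl
  rw [h]
  exact AddCircle.measurable_mk'.comp (F.monotone.measurable.comp
    (measurable_subtype_coe.comp (AddCircle.measurableEquivIco 1 0).measurable))

theorem circleMap_mul (F G : CircleDeg1Lift) :
    circleMap (F * G) = circleMap F ∘ circleMap G := by
  funext x
  induction x using QuotientAddGroup.induction_on with
  | H x => rfl

theorem circleMap_injective (F : CircleDeg1Lift) (hF : Function.Injective F) :
    Function.Injective (circleMap F) := by
  intro x y
  induction x using QuotientAddGroup.induction_on with
  | H x =>
  induction y using QuotientAddGroup.induction_on with
  | H y =>
  intro h
  change ((F x : ℝ) : S1) = (F y : S1) at h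
  change (x : S1) = (y : S1)
  obtain ⟨m, hm⟩ := coe_S1_eq_iff.1 h
  refine coe_S1_eq_iff.2 ⟨m, hF ?_⟩
  rw [hm, map_add_int]

/-- `s` separates the points where `G` is at most `x` from those where it exceeds `x`. -/
def IsThreshold (G : CircleDeg1Lift) (x s : ℝ) : Prop :=
  (∀ y < s, G y ≤ x) ∧ ∀ y > s, x < G y

theorem exists_isThreshold (G : CircleDeg1Lift) (x : ℝ) : ∃ s, IsThreshold G x s := by
  have hne : {y | G y ≤ x}.Nonempty := (G.tendsto_atBot.eventually_le_atBot x).exists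
  obtain ⟨b, hb⟩ := (G.tendsto_atTop.eventually_gt_atTop x).exists
  have hbdd : BddAbove {y | G y ≤ x} := ⟨b, fun y hy => by
    by_contra! hlt
    exact absurd (G.monotone hlt.le) (not_le.2 (lt_of_le_of_lt hy hb))⟩
  refine ⟨sSup {y | G y ≤ x}, fun y hy => ?_, fun y hy => ?_⟩
  · obtain ⟨z, hz, hyz⟩ := exists_lt_of_lt_csSup hne hy
    exact (G.monotone hyz.le).trans hz
  · by_contra! hle
    exact absurd (le_csSup hbdd hle) (not_le.2 hy)

theorem IsThreshold.add_one {G : CircleDeg1Lift} {x s : ℝ} (h : IsThreshold G x s) :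
    IsThreshold G (x + 1) (s + 1) := by
  have hG : ∀ y, G y = G (y - 1) + 1 := fun y => by rw [← map_add_one, sub_add_cancel]
  refine ⟨fun y hy => ?_, fun y hy => ?_⟩ <;> rw [hG y]
  · linarith [h.1 (y - 1) (by linarith)]
  · linarith [h.2 (y - 1) (by linarith)]

theorem IsThreshold.map {G F : CircleDeg1Lift} (hF : StrictMono F) {r : ℝ}
    (hGF : ∀ y, G (r + y) = F (G y)) {x s : ℝ} (h : IsThreshold G x s) :
    IsThreshold G (F x) (r + s) := by
  have hG : ∀ y, G y = F (G (y - r)) := fun y => by rw [← hGF, add_sub_cancel]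
  refine ⟨fun y hy => ?_, fun y hy => ?_⟩ <;> rw [hG y]
  · exact hF.monotone (h.1 (y - r) (by linarith))
  · exact hF (h.2 (y - r) (by linarith))

theorem IsThreshold.mono {G : CircleDeg1Lift} {x x' s s' : ℝ} (h : IsThreshold G x s)
    (h' : IsThreshold G x' s') (hx : x ≤ x') : s ≤ s' := by
  by_contra! hlt
  obtain ⟨y, hy1, hy2⟩ := exists_between hlt
  linarith [h'.2 y hy1, h.1 y hy2]

/-- The pushforward of Lebesgue measure by the circle map covered by `G`. -/
def pushVolume (G : CircleDeg1Lift) : Measure S1 := (volume : Measure S1).map (circleMap G)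

instance isProbabilityMeasure_pushVolume (G : CircleDeg1Lift) :
    IsProbabilityMeasure (pushVolume G) := by
  have : IsProbabilityMeasure (volume : Measure S1) := ⟨UnitAddCircle.measure_univ⟩
  exact Measure.isProbabilityMeasure_map (measurable_circleMap G).aemeasurable

theorem map_pushVolume {G F : CircleDeg1Lift} {r : ℝ} (hGF : ∀ y, G (r + y) = F (G y)) :
    (pushVolume G).map (circleMap F) = pushVolume G := by
  have hcomp : circleMap F ∘ circleMap G = circleMap G ∘ fun x => (r : S1) + x := by
    funext x
    induction x using QuotientAddGroup.induction_on with
    | H x => exact congrArg (fun z : ℝ => (z : S1)) (hGF x).symm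
  rw [pushVolume, Measure.map_map (measurable_circleMap F) (measurable_circleMap G), hcomp,
    ← Measure.map_map (measurable_circleMap G) (measurable_const_add _), map_add_left_eq_self]

theorem pushVolume_image_Ioo {G : CircleDeg1Lift} {x₁ x₂ s₁ s₂ : ℝ} (h₁ : IsThreshold G x₁ s₁)
    (h₂ : IsThreshold G x₂ s₂) (hx : x₁ ≤ x₂) (hx' : x₂ ≤ x₁ + 1)
    (hnull : ∀ p, pushVolume G {p} = 0) :
    pushVolume G ((fun x : ℝ => (x : S1)) '' Ioo x₁ x₂) = ENNReal.ofReal (s₂ - s₁) := by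
  have hs' : s₂ ≤ s₁ + 1 := h₂.mono h₁.add_one hx'
  have hopen : IsOpen ((fun x : ℝ => (x : S1)) '' Ioo x₁ x₂) :=
    QuotientAddGroup.isOpenMap_coe _ isOpen_Ioo
  have hmp := UnitAddCircle.measurePreserving_mk s₁
  have hpre : ∀ A : Set S1, MeasurableSet A → pushVolume G A =
      volume.restrict (Ioc s₁ (s₁ + 1)) {y : ℝ | (G y : S1) ∈ A} := by
    intro A hA
    rw [pushVolume, Measure.map_apply (measurable_circleMap G) hA,
      ← hmp.measure_preimage (measurable_circleMap G hA).nullMeasurableSet]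
    rfl
  have hpoint : ∀ p : S1, ∀ᵐ y : ℝ, y ∈ Ioc s₁ (s₁ + 1) → (G y : S1) ≠ p := by
    intro p
    rw [← ae_restrict_iff' measurableSet_Ioc, ae_iff]
    simpa [hpre _ (measurableSet_singleton p)] using hnull p
  rw [hpre _ hopen.measurableSet, Measure.restrict_apply' measurableSet_Ioc, ← Real.volume_Ioo]
  refine measure_congr ?_
  filter_upwards [hpoint x₁, hpoint x₂, Measure.ae_ne volume s₂, Measure.ae_ne volume (s₁ + 1)]
    with y hy1 hy2 hne hne1
  refine propext ⟨?_, ?_⟩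
  · rintro ⟨⟨z, hz, hzy⟩, hy⟩
    refine ⟨hy.1, ?_⟩
    by_contra! hge
    have hlt : y < s₁ + 1 := lt_of_le_of_ne hy.2 hne1
    have e1 : x₂ < G y := h₂.2 y (lt_of_le_of_ne hge hne.symm)
    have e2 : G y ≤ x₁ + 1 := h₁.add_one.1 y hlt
    have e3 : G y ≠ x₁ + 1 := fun h => hy1 hy (by rw [h]; exact coe_S1_eq_iff.2 ⟨1, by simp⟩)
    have := (AddCircle.coe_eq_coe_iff_of_mem_Ico (p := (1 : ℝ)) (a := x₁)
      ⟨hz.1.le, by linarith [hz.2]⟩ ⟨by linarith, lt_of_le_of_ne e2 e3⟩).1 hzy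
    linarith [hz.2]
  · rintro ⟨hy, hy'⟩
    have hmem : y ∈ Ioc s₁ (s₁ + 1) := ⟨hy, by linarith⟩
    exact ⟨⟨G y, ⟨h₁.2 y hy, lt_of_le_of_ne (h₂.1 y hy') fun h => hy2 hmem (by rw [h])⟩, rfl⟩,
      hmem⟩

theorem measure_singleton_eq_zero {F : CircleDeg1Lift} (hF : Function.Injective F)
    (hirr : Irrational (translationNumber F)) (μ : Measure S1) [IsFiniteMeasure μ]
    (hμ : μ.map (circleMap F) = μ) (p : S1) : μ {p} = 0 := by
  by_contra hp
  have hinj := circleMap_injective F hF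
  have hstep : ∀ q, μ {circleMap F q} = μ {q} := by
    intro q
    conv_lhs => rw [← hμ]
    rw [Measure.map_apply (measurable_circleMap F) (measurableSet_singleton _)]
    congr 1
    ext z
    exact hinj.eq_iff
  have hiter : ∀ n : ℕ, μ {(circleMap F)^[n] p} = μ {p} := by
    intro n
    induction n with
    | zero => rfl
    | succ n ih => rw [Function.iterate_succ_apply', hstep, ih]
  have hpow : ∀ (n : ℕ) (x : ℝ), (circleMap F)^[n] (x : S1) = ((F ^ n) x : S1) := by
    intro n x
    induction n with
    | zero => rfl
    | succ n ih => rw [Function.iterate_succ_apply', ih, circleMap_coe, pow_succ', mul_apply]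
  have hper : ∀ n : ℕ, 0 < n → (circleMap F)^[n] p ≠ p := by
    intro n hn
    induction p using QuotientAddGroup.induction_on with
    | H x =>
    intro h
    obtain ⟨m, hm⟩ := coe_S1_eq_iff.1 ((hpow n x).symm.trans h)
    have := translationNumber_of_map_pow_eq_add_int F hm hn
    exact hirr ⟨(m : ℚ) / n, by rw [this]; push_cast; rfl⟩
  have hinjiter : Function.Injective fun n : ℕ => (circleMap F)^[n] p := by
    refine Function.Injective.of_lt_imp_ne fun m n hmn h => hper (n - m) (Nat.sub_pos_of_lt hmn) ?_
    have h' : (circleMap F)^[m] ((circleMap F)^[n - m] p) = (circleMap F)^[m] p := by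
      rw [← Function.iterate_add_apply, Nat.add_sub_cancel' hmn.le]
      exact h.symm
    exact hinj.iterate m h'
  have htop := (Set.infinite_range_of_injective hinjiter).meas_eq_top (μ := μ)
    ⟨μ {p}, hp, by rintro _ ⟨n, rfl⟩; exact (hiter n).ge⟩
  exact measure_ne_top μ _ htop

end CircleDeg1Lift


/-- A strictly monotone function whose derivative is the square of a function with a simple zero
at `c` has a non-flat critical point (of cubic type) at `c`. -/
theorem nonFlatAt_of_deriv_eq_sq {P R : ℝ → ℝ} {c : ℝ} (hmono : StrictMono P)
    (hP : AnalyticAt ℝ P c) (hR : AnalyticAt ℝ R c) (hd : deriv P = R ^ 2) (hR0 : R c = 0)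
    (hR1 : deriv R c ≠ 0) : NonFlatAt P c := by
  have horder : analyticOrderAt (fun x => P x - P c) c = (3 : ℕ) := by
    rw [← hP.analyticOrderAt_deriv_add_one, hd, analyticOrderAt_pow hR,
      hR.analyticOrderAt_eq_one_of_zero_deriv_ne_zero hR0 hR1]
    norm_num
  obtain ⟨q, hq, hqc, hPq⟩ :=
    (hP.fun_sub analyticAt_const).analyticOrderAt_eq_natCast.1 horder
  have hqpos : 0 < q c := by
    by_contra! hle
    have hneg : ∀ᶠ x in 𝓝[>] c, q x < 0 :=
      (hq.continuousAt.eventually_lt_const (lt_of_le_of_ne hle hqc)).filter_mono nhdsWithin_le_nhds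
    obtain ⟨x, hxneg, hxP, hxc⟩ :=
      (hneg.and ((hPq.filter_mono nhdsWithin_le_nhds).and self_mem_nhdsWithin)).exists
    have hxc' : 0 < x - c := sub_pos.2 hxc
    have hPx : 0 < P x - P c := sub_pos.2 (hmono hxc)
    rw [hxP, smul_eq_mul] at hPx
    exact absurd hPx (not_lt.2 (mul_nonpos_of_nonneg_of_nonpos (by positivity) hxneg.le))
  set φ : ℝ → ℝ := fun x => (x - c) * q x ^ (1 / 3 : ℝ) with hφ
  have hroot : ContDiffAt ℝ 3 (fun x => q x ^ (1 / 3 : ℝ)) c :=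
    hq.contDiffAt.rpow_const_of_ne hqc
  have hφsmooth : ContDiffAt ℝ 3 φ c := (contDiffAt_id.sub contDiffAt_const).mul hroot
  have hφc : φ c = 0 := by simp [hφ]
  have hφ' : deriv φ c ≠ 0 := by
    have h1 : HasDerivAt φ (1 * q c ^ (1 / 3 : ℝ) + (c - c) * deriv (fun x => q x ^ (1 / 3 : ℝ)) c)
        c := ((hasDerivAt_id c).sub_const c).mul
          (hroot.differentiableAt (by norm_num)).hasDerivAt
    rw [h1.deriv]
    have := Real.rpow_pos_of_pos hqpos (1 / 3)
    simpa using this.ne'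
  have hderiv : ∀ᶠ x in 𝓝 c, deriv φ x ≠ 0 :=
    ContinuousAt.eventually_ne
      ((hφsmooth.continuousAt_fderiv (by norm_num)).clm_apply continuousAt_const) hφ'
  have hcube : ∀ᶠ x in 𝓝 c, P x = P c + φ x ^ 3 := by
    filter_upwards [hPq, hq.continuousAt.eventually_const_lt hqpos] with x hx hqx
    have : (q x ^ (1 / 3 : ℝ)) ^ 3 = q x := by
      rw [← Real.rpow_natCast, ← Real.rpow_mul hqx.le]
      norm_num
    simp only [hφ, mul_pow, this]
    rw [smul_eq_mul] at hx
    linarith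
  obtain ⟨W, hW, hWo, hcW⟩ := eventually_nhds_iff.1
    ((hφsmooth.eventually (by simp)).and (hderiv.and hcube))
  refine ⟨3, by norm_num, W, hWo, hcW, φ, fun x hx => (hW x hx).1.contDiffWithinAt, ?_,
    fun x hx => (hW x hx).2.1, hφc, fun x hx => ?_⟩
  · intro x hx y hy hxy
    apply hmono.injective
    rw [(hW x hx).2.2, (hW y hy).2.2, hxy]
  · rw [(hW x hx).2.2]
    have : |φ x| ^ ((3 : ℝ) - 1) = φ x ^ 2 := by
      rw [← sq_abs, ← Real.rpow_natCast]
      norm_num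
    rw [this]
    ring

/-- The critical Arnold family. -/
def arnoldFun (t x : ℝ) : ℝ := x + t - Real.sin (2 * Real.pi * x) / (2 * Real.pi)

theorem strictMono_arnoldFun (t : ℝ) : StrictMono (arnoldFun t) := by
  intro x y hxy
  have hπ := Real.pi_pos
  have hh : 0 < Real.pi * (y - x) := mul_pos hπ (sub_pos.2 hxy)
  have hsub := Real.sin_sub_sin (2 * Real.pi * y) (2 * Real.pi * x)
  rw [show (2 * Real.pi * y - 2 * Real.pi * x) / 2 = Real.pi * (y - x) by ring] at hsub
  have hlt : |Real.sin (Real.pi * (y - x))| < Real.pi * (y - x) := by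
    simpa [abs_of_pos hh] using Real.abs_sin_lt_abs hh.ne'
  have hcos := Real.abs_cos_le_one ((2 * Real.pi * y + 2 * Real.pi * x) / 2)
  have hbound : Real.sin (2 * Real.pi * y) - Real.sin (2 * Real.pi * x)
      < 2 * Real.pi * (y - x) := by
    rw [hsub]
    calc 2 * Real.sin (Real.pi * (y - x)) * Real.cos ((2 * Real.pi * y + 2 * Real.pi * x) / 2)
        ≤ 2 * |Real.sin (Real.pi * (y - x)) *
            Real.cos ((2 * Real.pi * y + 2 * Real.pi * x) / 2)| := by
          rw [mul_assoc]
          gcongr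
          exact le_abs_self _
      _ ≤ 2 * |Real.sin (Real.pi * (y - x))| := by
          rw [abs_mul]
          gcongr
          exact mul_le_of_le_one_right (abs_nonneg _) hcos
      _ < 2 * Real.pi * (y - x) := by linarith
  have hdiv : (Real.sin (2 * Real.pi * y) - Real.sin (2 * Real.pi * x)) / (2 * Real.pi)
      < y - x := by
    rw [div_lt_iff₀ (by positivity)]
    linarith
  rw [sub_div] at hdiv
  simp only [arnoldFun]
  linarith

theorem hasDerivAt_arnoldFun (t x : ℝ) :
    HasDerivAt (arnoldFun t) (2 * Real.sin (Real.pi * x) ^ 2) x := by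
  have hπ := Real.pi_ne_zero
  have h1 : HasDerivAt (fun x : ℝ => 2 * Real.pi * x) (2 * Real.pi) x := by
    simpa using (hasDerivAt_id x).const_mul (2 * Real.pi)
  have h2 := ((hasDerivAt_id x).add_const t).sub (h1.sin.div_const (2 * Real.pi))
  refine h2.congr_deriv ?_
  rw [mul_div_assoc, div_self (by positivity), mul_one, Real.sin_sq,
    show 2 * Real.pi * x = 2 * (Real.pi * x) by ring, Real.cos_two_mul]
  ring

theorem analyticAt_arnoldFun (t x : ℝ) : AnalyticAt ℝ (arnoldFun t) x := by
  unfold arnoldFun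
  fun_prop (disch := positivity)

theorem arnoldFun_add_one (t x : ℝ) : arnoldFun t (x + 1) = arnoldFun t x + 1 := by
  simp only [arnoldFun]
  rw [mul_add, mul_one, Real.sin_add_two_pi]
  ring

/-- The critical Arnold family as degree one lifts. -/
def arnold (t : ℝ) : CircleDeg1Lift where
  toFun := arnoldFun t
  monotone' := (strictMono_arnoldFun t).monotone
  map_add_one' := arnoldFun_add_one t

theorem coe_arnold (t : ℝ) : ⇑(arnold t) = arnoldFun t := rfl

theorem exists_translationNumber_arnold_eq {r : ℝ} (hr : r ∈ Icc (0 : ℝ) 1) :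
    ∃ t, CircleDeg1Lift.translationNumber (arnold t) = r := by
  have hcont : Continuous fun t => CircleDeg1Lift.translationNumber (arnold t) := by
    apply CircleDeg1Lift.continuous_translationNumber_of_continuous
    simp only [coe_arnold, arnoldFun]
    fun_prop
  have h0 : CircleDeg1Lift.translationNumber (arnold 0) = 0 := by
    simpa using CircleDeg1Lift.translationNumber_of_eq_add_int (arnold 0) (x := 0) (m := 0)
      (by simp [coe_arnold, arnoldFun])
  have h1 : CircleDeg1Lift.translationNumber (arnold 1) = 1 := by
    simpa using CircleDeg1Lift.translationNumber_of_eq_add_int (arnold 1) (x := 0) (m := 1)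
      (by simp [coe_arnold, arnoldFun])
  obtain ⟨t, -, ht⟩ := intermediate_value_Icc zero_le_one hcont.continuousOn
    (show r ∈ Icc _ _ by simpa only [h0, h1] using hr)
  exact ⟨t, ht⟩

theorem sin_pi_mul_eq_zero_iff {x : ℝ} : Real.sin (Real.pi * x) = 0 ↔ ∃ m : ℤ, x = m := by
  rw [Real.sin_eq_zero_iff]
  refine exists_congr fun m => ?_
  rw [mul_comm, mul_right_inj' Real.pi_ne_zero, eq_comm]

theorem hasDerivAt_sin_pi_mul (x : ℝ) :
    HasDerivAt (fun x : ℝ => Real.sin (Real.pi * x)) (Real.pi * Real.cos (Real.pi * x)) x := by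
  have h : HasDerivAt (fun x : ℝ => Real.pi * x) Real.pi x := by
    simpa using (hasDerivAt_id x).const_mul Real.pi
  simpa [mul_comm] using h.sin

/-- If the critical Arnold map moves every point by an amount in `(0, 1)`, its second iterate is
bi-critical, with critical points `0` and its preimage. -/
theorem bicritical_arnold_sq {t u : ℝ} (hu : arnold t u = 0) (hu0 : u < 0) (hu1 : 0 < u + 1)
    (hlt : 0 < arnold t 0) (hlt1 : arnold t 0 < 1) :
    Bicritical (CircleDeg1Lift.circleMap (arnold t ^ 2)) (u : S1) ((0 : ℝ) : S1) ⊤ := by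
  set F := arnoldFun t
  have hFa : ∀ x, arnold t x = F x := fun _ => rfl
  rw [hFa] at hu hlt hlt1
  have hmono : StrictMono F := strictMono_arnoldFun t
  have hmono2 : StrictMono (F ∘ F) := hmono.comp hmono
  have hlift : ⇑(arnold t ^ 2) = F ∘ F := by rw [pow_two, CircleDeg1Lift.coe_mul, coe_arnold]
  have hcont : Continuous (F ∘ F) := by
    have : Continuous F := continuous_iff_continuousAt.2 fun x =>
      (analyticAt_arnoldFun t x).continuousAt
    exact this.comp this
  have hP : ∀ x, AnalyticAt ℝ (F ∘ F) x := fun x =>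
    (analyticAt_arnoldFun t _).comp (analyticAt_arnoldFun t x)
  set R : ℝ → ℝ := fun x => 2 * (Real.sin (Real.pi * F x) * Real.sin (Real.pi * x)) with hRdef
  have hR : ∀ x, AnalyticAt ℝ R x := by
    intro x
    have := analyticAt_arnoldFun t x
    simp only [hRdef]
    fun_prop
  have hd : deriv (F ∘ F) = R ^ 2 := by
    funext x
    rw [((hasDerivAt_arnoldFun t (F x)).comp x (hasDerivAt_arnoldFun t x)).deriv]
    simp only [hRdef, Pi.pow_apply]
    ring
  have hR' : ∀ x, deriv R x = 2 * (Real.pi * Real.cos (Real.pi * F x)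
      * (2 * Real.sin (Real.pi * x) ^ 2) * Real.sin (Real.pi * x)
      + Real.sin (Real.pi * F x) * (Real.pi * Real.cos (Real.pi * x))) := by
    intro x
    exact ((((hasDerivAt_sin_pi_mul (F x)).comp x (hasDerivAt_arnoldFun t x)).mul
      (hasDerivAt_sin_pi_mul x)).const_mul 2).deriv
  have hnotint : ∀ {y : ℝ} (k : ℤ), (k : ℝ) < y → y < k + 1 → Real.sin (Real.pi * y) ≠ 0 := by
    intro y k h1 h2 h
    obtain ⟨m, rfl⟩ := sin_pi_mul_eq_zero_iff.1 h
    have h1' : k < m := by exact_mod_cast h1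
    have h2' : m < k + 1 := by exact_mod_cast h2
    omega
  have hsinu : Real.sin (Real.pi * u) ≠ 0 :=
    hnotint (-1) (by push_cast; linarith) (by push_cast; linarith)
  have hsinF : Real.sin (Real.pi * F 0) ≠ 0 :=
    hnotint 0 (by simpa using hlt) (by simpa using hlt1)
  have hπ := Real.pi_ne_zero
  refine ⟨?_, F ∘ F, u, 0, ?_, ?_, rfl, rfl, ?_, ?_, ?_⟩
  · intro h
    obtain ⟨m, hm⟩ := coe_S1_eq_iff.1 h
    exact hsinu (sin_pi_mul_eq_zero_iff.2 ⟨m, by simpa using hm⟩)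
  · rw [← hlift] at hmono2 hcont ⊢
    exact CircleDeg1Lift.isLift_circleMap hmono2
      ((CircleDeg1Lift.continuous_iff_surjective _).1 hcont)
  · exact contDiff_iff_contDiffAt.2 fun x => (hP x).contDiffAt
  · ext x
    simp only [hd, hRdef, Pi.pow_apply, mem_ofPred_eq, mem_union, ne_eq, OfNat.ofNat_ne_zero,
      not_false_eq_true, pow_eq_zero_iff, mul_eq_zero, false_or, sin_pi_mul_eq_zero_iff, zero_add]
    refine or_congr_left (exists_congr fun m => ?_)
    have : F (u + m) = m := by
      rw [← hFa, CircleDeg1Lift.map_add_int, hFa, hu, zero_add]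
    rw [← hmono.injective.eq_iff (a := x), this]
  · refine nonFlatAt_of_deriv_eq_sq hmono2 (hP u) (hR u) hd (by simp [hRdef, hu]) ?_
    rw [hR', hu]
    simpa [hπ] using hsinu
  · refine nonFlatAt_of_deriv_eq_sq hmono2 (hP 0) (hR 0) hd (by simp [hRdef]) ?_
    rw [hR']
    simpa [hπ] using hsinF

/-- **Lemma 7.2.** For every irrational `ρ ∈ (0,1)`, the pair `(ρ, ρ/2)` is admissible. -/
theorem admissibleHalf (ρ : ℝ) (hρ : ρ ∈ Ioo (0 : ℝ) 1) (hirr : Irrational ρ) :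
    Admissible ρ (ρ / 2) := by
  have hr : ρ / 2 ∈ Ioo (0 : ℝ) 1 := ⟨by linarith [hρ.1], by linarith [hρ.2]⟩
  obtain ⟨t, ht⟩ := exists_translationNumber_arnold_eq (Ioo_subset_Icc_self hr)
  set A := arnold t
  have hmono : StrictMono A := strictMono_arnoldFun t
  have hAcont : Continuous A := continuous_iff_continuousAt.2 fun x =>
    (analyticAt_arnoldFun t x).continuousAt
  have hsurj : Function.Surjective A := A.continuous_iff_surjective.1 hAcont
  have hgt : ∀ x, x < A x := fun x => by
    simpa using A.lt_map_of_int_lt_translationNumber (n := 0) (by simpa [ht] using hr.1) x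
  have hlt : ∀ x, A x < x + 1 := fun x => by
    simpa using A.map_lt_of_translationNumber_lt_int (n := 1) (by simpa [ht] using hr.2) x
  obtain ⟨u, hu⟩ := hsurj 0
  have hu0 : u < 0 := hu ▸ hgt u
  have hu1 : 0 < u + 1 := hu ▸ hlt u
  have hbi := bicritical_arnold_sq hu hu0 hu1 (hgt 0) (by simpa using hlt 0)
  obtain ⟨G, hG⟩ := CircleDeg1Lift.semiconj_of_isUnit_of_translationNumber_eq
    (f₁ := CircleDeg1Lift.translate (Multiplicative.ofAdd (ρ / 2))) (f₂ := A) (Units.isUnit _)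
    (CircleDeg1Lift.isUnit_iff_bijective.2 ⟨hmono.injective, hsurj⟩)
    (by rw [CircleDeg1Lift.translationNumber_translate, ht])
  have hGF : ∀ y, G (ρ / 2 + y) = A (G y) := fun y => by
    rw [← hG y, CircleDeg1Lift.translate_apply]
  have hinv := CircleDeg1Lift.map_pushVolume hGF
  have hirr' : Irrational (CircleDeg1Lift.translationNumber A) := by
    rw [ht]
    exact_mod_cast hirr.div_natCast two_ne_zero
  have hnull := CircleDeg1Lift.measure_singleton_eq_zero hmono.injective hirr'
    (CircleDeg1Lift.pushVolume G) hinv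
  obtain ⟨s, hs⟩ := G.exists_isThreshold u
  have hs0 : G.IsThreshold 0 (ρ / 2 + s) := hu ▸ hs.map hmono hGF
  refine ⟨_, _, _, CircleDeg1Lift.pushVolume G, hbi, ?_, inferInstance, ?_, ?_, ?_⟩
  · have hsq : ⇑(A ^ 2) = A ∘ A := by rw [pow_two, CircleDeg1Lift.coe_mul]
    refine ⟨⇑(A ^ 2), CircleDeg1Lift.isLift_circleMap (hsq ▸ hmono.comp hmono)
      (hsq ▸ hsurj.comp hsurj), ?_⟩
    have hlim := (A ^ 2).tendsto_translation_number₀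
    rw [CircleDeg1Lift.translationNumber_pow, ht] at hlim
    simpa [CircleDeg1Lift.coe_pow, mul_div_cancel₀] using hlim
  · have hm := CircleDeg1Lift.measurable_circleMap A
    rw [pow_two, CircleDeg1Lift.circleMap_mul, ← Measure.map_map hm hm, hinv, hinv]
  · rw [posArc_coe hu0 hu1, CircleDeg1Lift.pushVolume_image_Ioo hs hs0 hu0.le hu1.le hnull,
      ENNReal.toReal_ofReal (by linarith [hr.1])]
    ring
  · have hcoe : (u : S1) = ((u + 1 : ℝ) : S1) := coe_S1_eq_iff.2 ⟨-1, by simp⟩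
    rw [hcoe, posArc_coe hu1 (by linarith), CircleDeg1Lift.pushVolume_image_Ioo hs0 hs.add_one
      hu1.le (by linarith) hnull, ENNReal.toReal_ofReal (by linarith [hr.2])]
    ring
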